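/- arXiv:cs/9809115 — 2 statements merged into one kernel-verified Lean document; each statement's English description precedes it below -/
import Mathlib

section
/- Let n, m, k be natural numbers with k < n. Then there is no map h : (Fin n → Bool) → (Fin m → Bool) with the following two properties: (i) every output bit is local, i.e., for each j : Fin m there exists a finite set S_j ⊆ Fin n with |S_j| ≤ k such that for all x, y : Fin n → Bool agreeing on all coordinates in S_j one has h(x)(j) = h(y)(j); and (ii) h is a bit-reduction of the all-ones test to the contains-a-one test, i.e., for every x : Fin n → Bool, (∀ i, x i = true) holds if and only if (∃ j, h(x)(j) = true). This is the combinatorial content of the statement that U = 1* is not polylogarithmic-time bit-reducible to E = (0+1)*1(0+1)*, which by the oracle separation criterion yields an oracle separating coNP from NP. -/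
/-!
The combinatorial content of `U = 1* ≰_plt E = (0+1)*1(0+1)*`:
there is no bit-reduction `h` from the all-ones test to the
contains-a-one test in which every output bit depends on at most
`k < n` input coordinates.
-/

theorem no_local_bit_reduction {n m k : ℕ} (hk : k < n) :
    ¬ ∃ h : (Fin n → Bool) → (Fin m → Bool),
        (∀ j : Fin m, ∃ S : Finset (Fin n), S.card ≤ k ∧
          ∀ x y : Fin n → Bool, (∀ i ∈ S, x i = y i) → h x j = h y j) ∧
        (∀ x : Fin n → Bool, (∀ i, x i = true) ↔ ∃ j, h x j = true) := by
  rintro ⟨h, hlocal, hred⟩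
  obtain ⟨j, hj⟩ := (hred fun _ => true).1 fun _ => rfl
  obtain ⟨S, hS, hagree⟩ := hlocal j
  obtain ⟨i, hi⟩ : ∃ i, i ∉ S := by
    by_contra! hall
    have hcard : S.card = n := by
      rw [Finset.eq_univ_iff_forall.2 hall, Finset.card_univ, Fintype.card_fin]
    omega
  have hflip : h (Function.update (fun _ => true) i false) j = true := by
    refine (hagree _ _ fun a ha => Function.update_of_ne ?_ _ _).trans hj
    rintro rfl
    exact hi ha
  simpa using (hred _).2 ⟨j, hflip⟩ i
end

section
/- Define NOR-formulas over v Boolean variables inductively: for each i : Fin v the variable xᵢ is a NOR-formula of depth 0, and if φ and ψ are NOR-formulas then NOR(φ, ψ) is a NOR-formula of depth 1 + max(depth φ, depth ψ); the evaluation eval(φ, α) ∈ Bool of a formula φ under an assignment α : Fin v → Bool is defined by eval(xᵢ, α) = α(i) and eval(NOR(φ, ψ), α) = ¬(eval(φ, α) ∨ eval(ψ, α)). Let enc : Bool → S₅ be given by enc(false) = identity and enc(true) = (1 2 3 4 5). Then for every NOR-formula φ over v variables there exist m ≤ 16^(depth φ) and a list of m instructions I₁, …, I_m, where each instruction I_j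 is a triple (i_j, σ_j, τ_j) with i_j : Fin v and σ_j, τ_j ∈ S₅ and the value of I_j under assignment α is σ_j if α(i_j) = true and τ_j otherwise, such that for every assignment α : Fin v → Bool the product of the instruction values I₁(α)·I₂(α)·…·I_m(α), multiplied left to right, equals enc(eval(φ, α)). -/
/-!
Barrington's simulation of NOR-formulas by products over `S₅`.

Permutations of `{1,…,5}` are represented as permutations of `Fin 5`
(the paper's element `i` corresponds to `i - 1 : Fin 5`).  In Lean,
`(u * v) x = u (v x)`, i.e. in `u * v` the right factor is applied first;
the paper multiplies left to right, so the left-to-right product of a list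
of permutations is `l.foldl (fun s a => a * s) 1`.
-/

namespace BarringtonNor

abbrev S5 := Equiv.Perm (Fin 5)

/-- NOR-formulas over `v` Boolean variables. -/
inductive NorFormula (v : ℕ) : Type
  | var : Fin v → NorFormula v
  | nor : NorFormula v → NorFormula v → NorFormula v

namespace NorFormula

/-- Variables have depth 0; `NOR(φ, ψ)` has depth `1 + max (depth φ) (depth ψ)`. -/
def depth {v : ℕ} : NorFormula v → ℕ
  | var _ => 0
  | nor φ ψ => 1 + max φ.depth ψ.depth

/-- Evaluation under an assignment `α`. -/
def eval {v : ℕ} (α : Fin v → Bool) : NorFormula v → Bool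
  | var i => α i
  | nor φ ψ => !(φ.eval α || ψ.eval α)

end NorFormula

/-- `a₁ = (1 2 3 4 5)`. -/
def a₁ : S5 := c[(0 : Fin 5), 1, 2, 3, 4]

/-- The encoding `true ↦ (1 2 3 4 5)`, `false ↦ identity`. -/
def enc : Bool → S5
  | false => 1
  | true => a₁

/-- The value of the instruction `(i, σ, τ)` under assignment `α`:
`σ` if `α i = true`, and `τ` otherwise. -/
def instrVal {v : ℕ} (α : Fin v → Bool) (I : Fin v × S5 × S5) : S5 :=
  if α I.1 then I.2.1 else I.2.2

/-- The left-to-right product of a list of permutations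
(the first element of the list is applied first). -/
def lrProd (l : List S5) : S5 := l.foldl (fun s a => a * s) 1

namespace NorFormula

/-- Some variable occurring in the formula. -/
def someVar {v : ℕ} : NorFormula v → Fin v
  | var i => i
  | nor φ _ => φ.someVar

end NorFormula

theorem lrProd_eq_prod_reverse (l : List S5) : lrProd l = l.reverse.prod := by
  simp [lrProd, List.prod_eq_foldr]

theorem lrProd_append (l₁ l₂ : List S5) : lrProd (l₁ ++ l₂) = lrProd l₂ * lrProd l₁ := by
  simp [lrProd_eq_prod_reverse]

theorem lrProd_cons (a : S5) (l : List S5) : lrProd (a :: l) = lrProd l * a := by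
  simp [lrProd_eq_prod_reverse]

/-- The NOR word `b x x x x c y y y y d x e y f`, with `b = (2 3)(4 5)`, `c = (1 2 4 3 5)`,
`d = (2 4 3)`, `e = (3 4 5)`, `f = (1 5 2)`. It is written from right to left because the
multiplication of `Equiv.Perm` applies the right factor first. -/
def norWord (x y : S5) : S5 :=
  c[(0 : Fin 5), 4, 1] * y * c[(2 : Fin 5), 3, 4] * x * c[(1 : Fin 5), 3, 2] * y * y * y * y *
    c[(0 : Fin 5), 1, 3, 2, 4] * x * x * x * x * (c[(1 : Fin 5), 2] * c[(3 : Fin 5), 4])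

set_option maxRecDepth 10000 in
theorem norWord_enc (p q : Bool) : norWord (enc p) (enc q) = enc (!(p || q)) := by
  revert p q
  decide

/-- The program obtained by substituting the programs `X` and `Y` into the NOR word; the constant
letters become instructions reading the variable `i`. -/
def norProgram {v : ℕ} (i : Fin v) (X Y : List (Fin v × S5 × S5)) : List (Fin v × S5 × S5) :=
  let const (σ : S5) : Fin v × S5 × S5 := (i, σ, σ)
  const (c[(1 : Fin 5), 2] * c[(3 : Fin 5), 4]) :: (X ++ X ++ X ++ X) ++
    const c[(0 : Fin 5), 1, 3, 2, 4] :: (Y ++ Y ++ Y ++ Y) ++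
    const c[(1 : Fin 5), 3, 2] :: X ++ const c[(2 : Fin 5), 3, 4] :: Y ++
    [const c[(0 : Fin 5), 4, 1]]

theorem length_norProgram {v : ℕ} (i : Fin v) (X Y : List (Fin v × S5 × S5)) :
    (norProgram i X Y).length = 5 * X.length + 5 * Y.length + 5 := by
  simp only [norProgram, List.length_append, List.length_cons, List.length_nil]
  omega

theorem lrProd_norProgram {v : ℕ} (i : Fin v) (X Y : List (Fin v × S5 × S5))
    (α : Fin v → Bool) :
    lrProd ((norProgram i X Y).map (instrVal α)) =
      norWord (lrProd (X.map (instrVal α))) (lrProd (Y.map (instrVal α))) := by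
  have instrVal_const (σ : S5) : instrVal α (i, σ, σ) = σ := ite_self σ
  have lrProd_nil : lrProd [] = 1 := rfl
  simp only [norProgram, norWord, List.map_append, List.map_cons, List.map_nil, lrProd_append,
    lrProd_cons, lrProd_nil, instrVal_const, one_mul, mul_assoc]

/-- Every NOR-formula `φ` is computed by a width-5 branching program of
length at most `16 ^ depth φ`: a list of instructions whose left-to-right
product of values under any assignment `α` equals `enc (eval φ α)`. -/
theorem norFormula_branching_program {v : ℕ} (φ : NorFormula v) :
    ∃ (m : ℕ) (L : List (Fin v × S5 × S5)),
      m ≤ 16 ^ φ.depth ∧ L.length = m ∧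
      ∀ α : Fin v → Bool, lrProd (L.map (instrVal α)) = enc (φ.eval α) := by
  induction φ with
  | var i =>
    refine ⟨1, [(i, a₁, 1)], by simp [NorFormula.depth], rfl, fun α => ?_⟩
    cases h : α i <;> simp [lrProd, instrVal, NorFormula.eval, enc, h]
  | nor φ ψ ihφ ihψ =>
    obtain ⟨_, X, hXlen, rfl, hX⟩ := ihφ
    obtain ⟨_, Y, hYlen, rfl, hY⟩ := ihψ
    refine ⟨_, norProgram φ.someVar X Y, ?_, rfl, fun α => ?_⟩
    · have hX' : X.length ≤ 16 ^ max φ.depth ψ.depth :=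
        hXlen.trans (Nat.pow_le_pow_right (by simp) (le_max_left _ _))
      have hY' : Y.length ≤ 16 ^ max φ.depth ψ.depth :=
        hYlen.trans (Nat.pow_le_pow_right (by simp) (le_max_right _ _))
      have hpos : 0 < 16 ^ max φ.depth ψ.depth := by positivity
      rw [length_norProgram, NorFormula.depth, pow_add, pow_one]
      omega
    · rw [lrProd_norProgram, hX, hY, norWord_enc, NorFormula.eval]

end BarringtonNor
end
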